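/- There exists a constant C > 0 such that for every sufficiently large n ∈ 16ℕ: 2^n ‖v_{0,n} − n^{−1/4}‖_{L^∞(𝕋)} + ‖∂_x v_{0,n}‖_{L^∞(𝕋)} ≤ C n^{−1/4} log n, and ‖v_{0,n}‖_{B^1_{∞,1}(𝕋)} ≤ C n^{−1/4} log n. -/

import Mathlib

open MeasureTheory Filter Function
open scoped ENNReal NNReal

noncomputable section

/-- The Fourier coefficient `û(ξ) = ∫_{-π}^{π} e^{-i x ξ} u(x) dx` of a `2π`-periodic
function on the torus. -/
def fCoeff (u : ℝ → ℂ) (ξ : ℤ) : ℂ :=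
  ∫ x in (-Real.pi)..Real.pi, Complex.exp (-Complex.I * x * ξ) * u x

/-- A Littlewood–Paley cutoff function: smooth, even, `0 ≤ χ ≤ 1`, `χ = 1` on `[-3/4,3/4]`,
`supp χ ⊆ (-4/3, 4/3)`, nonincreasing on `[0,∞)`. -/
structure LPCutoff where
  χ : ℝ → ℝ
  smooth : ContDiff ℝ (⊤ : ℕ∞) χ
  even : ∀ x, χ (-x) = χ x
  nonneg : ∀ x, 0 ≤ χ x
  le_one : ∀ x, χ x ≤ 1
  eq_one : ∀ x ∈ Set.Icc (-(3/4) : ℝ) (3/4 : ℝ), χ x = 1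
  supp : ∀ x, χ x ≠ 0 → x ∈ Set.Ioo (-(4/3) : ℝ) (4/3 : ℝ)
  decay : AntitoneOn χ (Set.Ici 0)

/-- `φ(ξ) = χ(ξ/2) - χ(ξ)`. -/
def LPCutoff.phi (c : LPCutoff) (x : ℝ) : ℝ := c.χ (x / 2) - c.χ x

/-- The dyadic block `Δ_j u` (for `j ≥ -1`). -/
def LPblock (c : LPCutoff) (j : ℤ) (u : ℝ → ℂ) (x : ℝ) : ℂ :=
  if j = -1 then
    (1 / (2 * Real.pi)) * ∑' ξ : ℤ, (c.χ ξ : ℂ) * fCoeff u ξ * Complex.exp (Complex.I * x * ξ)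
  else
    (1 / (2 * Real.pi)) *
      ∑' ξ : ℤ, (c.phi ((2:ℝ) ^ (-j) * ξ) : ℂ) * fCoeff u ξ * Complex.exp (Complex.I * x * ξ)

/-- The low-frequency cut-off `S_j u`. -/
def LPlow (c : LPCutoff) (j : ℤ) (u : ℝ → ℂ) (x : ℝ) : ℂ :=
  (1 / (2 * Real.pi)) *
    ∑' ξ : ℤ, (c.χ ((2:ℝ) ^ (-j) * ξ) : ℂ) * fCoeff u ξ * Complex.exp (Complex.I * x * ξ)

/-- The `L^∞(𝕋)` (sup) norm, with values in `ℝ≥0∞`. -/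
def supNormE {E : Type*} [NormedAddCommGroup E] (f : ℝ → E) : ℝ≥0∞ :=
  ⨆ x : ℝ, (‖f x‖₊ : ℝ≥0∞)

/-- View a real-valued function as a complex-valued one. -/
def toC (f : ℝ → ℝ) : ℝ → ℂ := fun x => (f x : ℂ)

/-- The `2π`-periodic square wave: `1/2` on `(0,π)`, `-1/2` on `(-π,0)`, `0` on `{-π,0,π}`. -/
def hFun (x : ℝ) : ℝ :=
  let y := x - 2 * Real.pi * ⌊(x + Real.pi) / (2 * Real.pi)⌋
  if y = 0 ∨ y = -Real.pi then 0 else if 0 < y then 1/2 else -1/2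

/-- The low-frequency part `f_n = S_{n/2} h` (real-valued). -/
def fLow (c : LPCutoff) (n : ℕ) : ℝ → ℝ := fun x => (LPlow c ((n : ℤ) / 2) (toC hFun) x).re

/-- The initial data `v_{0,n}` for the periodic Novikov equation. -/
def v0NV (c : LPCutoff) (n : ℕ) : ℝ → ℝ := fun x =>
  (2:ℝ) ^ (-(n:ℤ)) * (n:ℝ) ^ (-(1:ℝ)/4) * Real.log n * Real.cos ((2:ℝ) ^ (n:ℕ) * x) *
    (1 + (n:ℝ) ^ (-(1:ℝ)/4) * fLow c n x) + (n:ℝ) ^ (-(1:ℝ)/4)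

/-- The `B^1_{∞,1}(𝕋)` norm `Σ_{j ≥ -1} 2^j ‖Δ_j u‖_{L^∞}`, with values in `ℝ≥0∞`. -/
def besov1E (c : LPCutoff) (u : ℝ → ℂ) : ℝ≥0∞ :=
  ∑' k : ℕ, (2:ℝ≥0∞) ^ ((k:ℤ) - 1) * supNormE (LPblock c ((k:ℤ) - 1) u)


def eeX (ξ : ℤ) (x : ℝ) : ℂ := Complex.exp (Complex.I * x * ξ)

def OpX (M : ℤ → ℂ) (u : ℝ → ℂ) (x : ℝ) : ℂ :=
  (1 / (2 * Real.pi)) * ∑' ξ : ℤ, M ξ * fCoeff u ξ * Complex.exp (Complex.I * x * ξ)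

lemma eeX_cont (ξ : ℤ) : Continuous (eeX ξ) := by unfold eeX; fun_prop

lemma eeX_add (ξ η : ℤ) (x : ℝ) : eeX (ξ + η) x = eeX ξ x * eeX η x := by
  unfold eeX; rw [← Complex.exp_add]; push_cast; ring_nf

lemma eeX_norm (ξ : ℤ) (x : ℝ) : ‖eeX ξ x‖ = 1 := by
  unfold eeX
  have : Complex.I * x * ξ = ((x * ξ : ℝ) : ℂ) * Complex.I := by push_cast; ring
  rw [this, Complex.norm_exp_ofReal_mul_I]

lemma fCoeff_add {u v : ℝ → ℂ} (hu : Continuous u) (hv : Continuous v) (ξ : ℤ) :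
    fCoeff (fun x => u x + v x) ξ = fCoeff u ξ + fCoeff v ξ := by
  unfold fCoeff
  rw [← intervalIntegral.integral_add]
  · congr 1; ext x; ring
  · apply Continuous.intervalIntegrable; fun_prop
  · apply Continuous.intervalIntegrable; fun_prop

lemma fCoeff_smul (a : ℂ) (u : ℝ → ℂ) (ξ : ℤ) :
    fCoeff (fun x => a * u x) ξ = a * fCoeff u ξ := by
  unfold fCoeff
  rw [← intervalIntegral.integral_const_mul]
  congr 1; ext x; ring

lemma fCoeff_ee (ξ η : ℤ) : fCoeff (eeX η) ξ = if ξ = η then (2 * Real.pi : ℂ) else 0 := by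
  unfold fCoeff eeX
  split_ifs with h
  · subst h
    have : ∀ x : ℝ, Complex.exp (-Complex.I * x * ξ) * Complex.exp (Complex.I * x * ξ) = 1 := by
      intro x; rw [← Complex.exp_add]; ring_nf; simp
    simp only [this]
    simp; ring
  · have hc : (Complex.I * ((η : ℂ) - ξ)) ≠ 0 := by
      apply mul_ne_zero Complex.I_ne_zero
      rw [sub_ne_zero]; exact fun h' => h (by exact_mod_cast h'.symm)
    have : ∀ x : ℝ, Complex.exp (-Complex.I * x * ξ) * Complex.exp (Complex.I * x * η)
        = Complex.exp (Complex.I * ((η : ℂ) - ξ) * x) := by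
      intro x; rw [← Complex.exp_add]; ring_nf
    simp only [this]
    rw [integral_exp_mul_complex hc, div_eq_zero_iff]
    left
    rw [sub_eq_zero, Complex.exp_eq_exp_iff_exists_int]
    refine ⟨η - ξ, ?_⟩
    push_cast; ring

lemma OpX_add {M : ℤ → ℂ} (hM : M.support.Finite) {u v : ℝ → ℂ}
    (hu : Continuous u) (hv : Continuous v) (x : ℝ) :
    OpX M (fun x => u x + v x) x = OpX M u x + OpX M v x := by
  have hs : ∀ u : ℝ → ℂ, Summable (fun ξ : ℤ => M ξ * fCoeff u ξ * Complex.exp (Complex.I * x * ξ)) := by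
    intro u
    apply summable_of_hasFiniteSupport
    apply hM.subset
    intro ξ h h0
    apply h; simp [h0]
  unfold OpX
  rw [← mul_add, ← (hs u).tsum_add (hs v)]
  congr 2; ext ξ; rw [fCoeff_add hu hv]; ring

lemma OpX_smul (M : ℤ → ℂ) (a : ℂ) (u : ℝ → ℂ) (x : ℝ) :
    OpX M (fun x => a * u x) x = a * OpX M u x := by
  unfold OpX
  rw [mul_left_comm, ← tsum_mul_left (a := a)]
  congr 2; ext ξ; rw [fCoeff_smul]; ring

lemma OpX_ee (M : ℤ → ℂ) (η : ℤ) (x : ℝ) : OpX M (eeX η) x = M η * eeX η x := by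
  unfold OpX
  rw [tsum_eq_single η]
  · rw [fCoeff_ee, if_pos rfl]
    have : (Real.pi : ℂ) ≠ 0 := by exact_mod_cast Real.pi_ne_zero
    unfold eeX; field_simp
  · intro ξ h; rw [fCoeff_ee, if_neg h]; simp

lemma OpX_sum {M : ℤ → ℂ} (hM : M.support.Finite) (u : ℕ → ℝ → ℂ)
    (hu : ∀ j, Continuous (u j)) (J : ℕ) (x : ℝ) :
    OpX M (fun x => ∑ j ∈ Finset.range J, u j x) x = ∑ j ∈ Finset.range J, OpX M (u j) x := by
  induction J with
  | zero =>
    have := OpX_smul M 0 (fun _ => 0) x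
    simpa using this
  | succ J ih =>
    simp only [Finset.sum_range_succ]
    rw [OpX_add hM (u := fun x => ∑ j ∈ Finset.range J, u j x) (continuous_finsetSum _ fun j _ => hu j) (hu J), ih]

/-- Abel summation -/
lemma abelX (w s : ℕ → ℝ) (B : ℝ) (hw : Antitone w) (h0 : ∀ i, 0 ≤ w i)
    (hs : ∀ J, |∑ i ∈ Finset.range J, s i| ≤ B) (J : ℕ) :
    |∑ i ∈ Finset.range J, w i * s i| ≤ w 0 * B := by
  have key : |∑ i ∈ Finset.range J, w i * s i - w J * ∑ i ∈ Finset.range J, s i|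
      ≤ (w 0 - w J) * B := by
    induction J with
    | zero => simp
    | succ J ih =>
      have e : ∑ i ∈ Finset.range (J+1), w i * s i - w (J+1) * ∑ i ∈ Finset.range (J+1), s i
        = (∑ i ∈ Finset.range J, w i * s i - w J * ∑ i ∈ Finset.range J, s i)
          + (w J - w (J+1)) * ∑ i ∈ Finset.range (J+1), s i := by
        rw [Finset.sum_range_succ (fun i => w i * s i), Finset.sum_range_succ s]; ring
      rw [e]
      have h1 := abs_add_le (∑ i ∈ Finset.range J, w i * s i - w J * ∑ i ∈ Finset.range J, s i)
        ((w J - w (J+1)) * ∑ i ∈ Finset.range (J+1), s i)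
      have hd : 0 ≤ w J - w (J+1) := sub_nonneg.2 (hw (Nat.le_succ J))
      rw [abs_mul, abs_of_nonneg hd] at h1
      have := mul_le_mul_of_nonneg_left (hs (J+1)) hd
      linarith
  have h2 : |w J * ∑ i ∈ Finset.range J, s i| ≤ w J * B := by
    rw [abs_mul, abs_of_nonneg (h0 J)]
    exact mul_le_mul_of_nonneg_left (hs J) (h0 J)
  rw [abs_le] at *
  constructor <;> linarith [key.1, key.2, h2.1, h2.2]

lemma sin_oddX (x : ℝ) (j : ℕ) : |Real.sin ((2 * j + 1 : ℝ) * x)| ≤ (2 * j + 1) * |Real.sin x| := by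
  have gen : ∀ k : ℕ, |Real.sin (k * x)| ≤ k * |Real.sin x| := by
    intro k
    induction k with
    | zero => simp
    | succ k ih =>
      have : ((k + 1 : ℕ) : ℝ) * x = k * x + x := by push_cast; ring
      rw [this, Real.sin_add]
      have h1 := abs_add_le (Real.sin (k*x) * Real.cos x) (Real.cos (k*x) * Real.sin x)
      rw [abs_mul, abs_mul] at h1
      have h2 := mul_le_mul_of_nonneg_left (Real.abs_cos_le_one x) (abs_nonneg (Real.sin (k*x)))
      have h3 := mul_le_mul_of_nonneg_right (Real.abs_cos_le_one (k*x)) (abs_nonneg (Real.sin x))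
      push_cast
      linarith
  have := gen (2 * j + 1)
  push_cast at this
  exact this

lemma sin_sumX (x : ℝ) (J : ℕ) :
    Real.sin x * ∑ j ∈ Finset.range J, Real.sin ((2 * j + 1 : ℝ) * x) = Real.sin (J * x) ^ 2 := by
  induction J with
  | zero => simp
  | succ J ih =>
    rw [Finset.sum_range_succ, mul_add, ih]
    have e1 : (2 * J + 1 : ℝ) * x = J * x + (J * x + x) := by ring
    have e2 : ((J + 1 : ℕ) : ℝ) * x = J * x + x := by push_cast; ring
    rw [e1, e2]
    generalize (J : ℝ) * x = y
    rw [Real.sin_add y (y+x), Real.sin_add y x, Real.cos_add y x]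
    have h1 := Real.sin_sq_add_cos_sq y
    have h2 := Real.sin_sq_add_cos_sq x
    have : Real.cos y ^2 = 1 - Real.sin y ^ 2 := by linarith
    have h3 : Real.cos x ^2 = 1 - Real.sin x ^ 2 := by linarith
    ring_nf
    simp only [this, h3]
    ring

lemma sin_bddX (w : ℕ → ℝ) (hw : Antitone w) (h0 : ∀ i, 0 ≤ w i)
    (h1 : ∀ i : ℕ, w i ≤ 1 / (2 * i + 1)) (x : ℝ) (J : ℕ) :
    |∑ j ∈ Finset.range J, w j * Real.sin ((2 * j + 1 : ℝ) * x)| ≤ 3 := by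
  have first : ∀ J : ℕ, |∑ j ∈ Finset.range J, w j * Real.sin ((2 * j + 1 : ℝ) * x)|
      ≤ J * |Real.sin x| := by
    intro J
    refine (Finset.abs_sum_le_sum_abs _ _).trans ?_
    have : ∀ j ∈ Finset.range J, |w j * Real.sin ((2 * j + 1 : ℝ) * x)| ≤ |Real.sin x| := by
      intro j _
      rw [abs_mul, abs_of_nonneg (h0 j)]
      calc _ ≤ 1 / (2 * (j:ℝ) + 1) * ((2 * j + 1) * |Real.sin x|) :=
            mul_le_mul (h1 j) (sin_oddX x j) (abs_nonneg _) (by positivity)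
        _ = _ := by field_simp
    refine (Finset.sum_le_sum this).trans ?_
    simp
  rcases eq_or_ne (Real.sin x) 0 with hx | hx
  · have := first J
    rw [hx] at this; simp only [abs_zero, mul_zero] at this; linarith
  have hp : 0 < |Real.sin x| := abs_pos.2 hx
  set j0 := ⌈1 / |Real.sin x|⌉₊ with hj0
  have hj1 : 1 / |Real.sin x| ≤ j0 := Nat.le_ceil _
  have hj2 : (j0:ℝ) < 1 / |Real.sin x| + 1 := Nat.ceil_lt_add_one (by positivity)
  have hs1 : |Real.sin x| ≤ 1 := Real.abs_sin_le_one x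
  have hb : (j0:ℝ) * |Real.sin x| ≤ 2 := by
    have := mul_le_mul_of_nonneg_right hj2.le hp.le
    have e : (1 / |Real.sin x| + 1) * |Real.sin x| = 1 + |Real.sin x| := by field_simp
    linarith
  have hb' : 1 ≤ (j0:ℝ) * |Real.sin x| := by
    rwa [div_le_iff₀ hp] at hj1
  rcases le_total J j0 with hJ | hJ
  · have : (J:ℝ) * |Real.sin x| ≤ j0 * |Real.sin x| := by gcongr
    linarith [first J]
  · obtain ⟨r, rfl⟩ := Nat.exists_eq_add_of_le hJ
    rw [Finset.sum_range_add]
    have part : ∀ J : ℕ, |∑ j ∈ Finset.range J, Real.sin ((2 * j + 1 : ℝ) * x)| ≤ 1 / |Real.sin x| := by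
      intro J
      rw [le_div_iff₀ hp, ← abs_mul, mul_comm, sin_sumX, abs_of_nonneg (sq_nonneg _)]
      exact Real.sin_sq_le_one _
    have tail := abelX (fun i => w (j0 + i)) (fun i => Real.sin ((2 * (j0 + i : ℕ) + 1 : ℝ) * x))
      (2 / |Real.sin x|) (fun a b h => hw (by omega)) (fun i => h0 _) (by
        intro J
        have e := Finset.sum_range_add (fun j : ℕ => Real.sin ((2 * j + 1 : ℝ) * x)) j0 J
        have e1 := part (j0 + J)
        have e2 := part j0
        rw [e] at e1
        have : 2 / |Real.sin x| = 1 / |Real.sin x| + 1 / |Real.sin x| := by ring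
        rw [this]
        rw [abs_le] at *
        constructor <;> linarith [e1.1, e1.2, e2.1, e2.2]) r
    have hw0 : w (j0 + 0) * (2 / |Real.sin x|) ≤ 1 := by
      calc _ ≤ 1 / (2 * (j0:ℝ) + 1) * (2 / |Real.sin x|) := by
            gcongr; exact h1 j0
        _ ≤ 1 := by
            rw [div_mul_div_comm, div_le_one (by positivity)]
            nlinarith
    have := first j0
    refine (abs_add_le _ _).trans ?_
    have t2 := tail.trans hw0
    linarith

lemma hFun_posX {x : ℝ} (h0 : 0 < x) (h1 : x < Real.pi) : hFun x = 1/2 := by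
  have hp := Real.pi_pos
  have : ⌊(x + Real.pi) / (2 * Real.pi)⌋ = 0 := by
    rw [Int.floor_eq_zero_iff]
    constructor
    · positivity
    · rw [div_lt_one (by positivity)]; linarith
  unfold hFun
  simp only [this, Int.cast_zero, mul_zero, sub_zero]
  rw [if_neg (by rintro (h | h) <;> linarith), if_pos h0]

lemma hFun_negX {x : ℝ} (h0 : x < 0) (h1 : -Real.pi < x) : hFun x = -1/2 := by
  have hp := Real.pi_pos
  have : ⌊(x + Real.pi) / (2 * Real.pi)⌋ = 0 := by
    rw [Int.floor_eq_zero_iff]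
    constructor
    · apply div_nonneg <;> linarith
    · rw [div_lt_one (by positivity)]; linarith
  unfold hFun
  simp only [this, Int.cast_zero, mul_zero, sub_zero]
  rw [if_neg (by rintro (h | h) <;> linarith), if_neg (by linarith)]

lemma fCoeff_hX (ξ : ℤ) : fCoeff (toC hFun) ξ =
    (1/2) * (∫ x in (0:ℝ)..Real.pi, Complex.exp ((-Complex.I * ξ) * x))
    - (1/2) * (∫ x in (-Real.pi)..0, Complex.exp ((-Complex.I * ξ) * x)) := by
  have hp := Real.pi_pos
  have c1 : IntervalIntegrable (fun x : ℝ => Complex.exp ((-Complex.I * ξ) * x) * (1/2)) volume 0 Real.pi := by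
    apply Continuous.intervalIntegrable; fun_prop
  have c2 : IntervalIntegrable (fun x : ℝ => Complex.exp ((-Complex.I * ξ) * x) * (-1/2)) volume (-Real.pi) 0 := by
    apply Continuous.intervalIntegrable; fun_prop
  have e1 : Set.EqOn (fun x : ℝ => Complex.exp ((-Complex.I * ξ) * x) * (1/2)) (fun x : ℝ => Complex.exp (-Complex.I * x * ξ) * toC hFun x)
     (Set.Ioo 0 Real.pi) := by
    intro x hx
    simp only [toC, hFun_posX hx.1 hx.2]
    push_cast; ring_nf
  have e2 : Set.EqOn (fun x : ℝ => Complex.exp ((-Complex.I * ξ) * x) * (-1/2)) (fun x : ℝ => Complex.exp (-Complex.I * x * ξ) * toC hFun x)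
     (Set.Ioo (-Real.pi) 0) := by
    intro x hx
    simp only [toC, hFun_negX hx.2 hx.1]
    push_cast; ring_nf
  have i1 : IntervalIntegrable (fun x : ℝ => Complex.exp (-Complex.I * x * ξ) * toC hFun x) volume 0 Real.pi := by
    rw [intervalIntegrable_iff_integrableOn_Ioo_of_le hp.le] at c1 ⊢
    exact c1.congr_fun e1 measurableSet_Ioo
  have i2 : IntervalIntegrable (fun x : ℝ => Complex.exp (-Complex.I * x * ξ) * toC hFun x) volume (-Real.pi) 0 := by
    rw [intervalIntegrable_iff_integrableOn_Ioo_of_le (by linarith)] at c2 ⊢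
    exact c2.congr_fun e2 measurableSet_Ioo
  unfold fCoeff
  rw [← intervalIntegral.integral_add_adjacent_intervals i2 i1]
  have j1 : ∫ x in (0:ℝ)..Real.pi, Complex.exp (-Complex.I * x * ξ) * toC hFun x
     = ∫ x in (0:ℝ)..Real.pi, Complex.exp ((-Complex.I * ξ) * x) * (1/2) := by
    rw [intervalIntegral.integral_of_le hp.le, intervalIntegral.integral_of_le hp.le,
      integral_Ioc_eq_integral_Ioo, integral_Ioc_eq_integral_Ioo]
    exact (setIntegral_congr_fun measurableSet_Ioo e1).symm
  have j2 : ∫ x in (-Real.pi)..0, Complex.exp (-Complex.I * x * ξ) * toC hFun x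
     = ∫ x in (-Real.pi)..0, Complex.exp ((-Complex.I * ξ) * x) * (-1/2) := by
    rw [intervalIntegral.integral_of_le (by linarith), intervalIntegral.integral_of_le (by linarith),
      integral_Ioc_eq_integral_Ioo, integral_Ioc_eq_integral_Ioo]
    exact (setIntegral_congr_fun measurableSet_Ioo e2).symm
  rw [j1, j2, intervalIntegral.integral_mul_const, intervalIntegral.integral_mul_const]
  ring

lemma fCoeff_h_evenX {ξ : ℤ} (h : Even ξ) : fCoeff (toC hFun) ξ = 0 := by
  rw [fCoeff_hX]
  rcases eq_or_ne ξ 0 with rfl | h0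
  · simp
  · obtain ⟨k, hk⟩ := h
    have hc : -Complex.I * (ξ:ℂ) ≠ 0 := mul_ne_zero (neg_ne_zero.2 Complex.I_ne_zero) (by exact_mod_cast h0)
    have a1 : Complex.exp (-Complex.I * ξ * Real.pi) = 1 := by
      rw [Complex.exp_eq_one_iff]; exact ⟨-k, by rw [hk]; push_cast; ring⟩
    have a2 : Complex.exp (-Complex.I * ξ * (-Real.pi : ℝ)) = 1 := by
      rw [Complex.exp_eq_one_iff]; exact ⟨k, by rw [hk]; push_cast; ring⟩
    rw [integral_exp_mul_complex hc, integral_exp_mul_complex hc, a1, a2]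
    simp

lemma fCoeff_h_oddX {ξ : ℤ} (h : Odd ξ) : fCoeff (toC hFun) ξ = -2 * Complex.I / ξ := by
  rw [fCoeff_hX]
  have h0 : ξ ≠ 0 := by rintro rfl; simp at h
  have h0' : (ξ:ℂ) ≠ 0 := by exact_mod_cast h0
  obtain ⟨k, hk⟩ := h
  have hc : -Complex.I * (ξ:ℂ) ≠ 0 := mul_ne_zero (neg_ne_zero.2 Complex.I_ne_zero) h0'
  have b1 : ∀ k : ℤ, Complex.exp (Real.pi * Complex.I + k * (2 * Real.pi * Complex.I)) = -1 := by
    intro k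
    rw [Complex.exp_add, Complex.exp_pi_mul_I, Complex.exp_int_mul_two_pi_mul_I]; ring
  have a1 : Complex.exp (-Complex.I * ξ * Real.pi) = -1 := by
    rw [← b1 (-k-1), hk]; congr 1; push_cast; ring
  have a2 : Complex.exp (-Complex.I * ξ * (-Real.pi : ℝ)) = -1 := by
    rw [← b1 k, hk]; congr 1; push_cast; ring
  rw [integral_exp_mul_complex hc, integral_exp_mul_complex hc, a1, a2]
  simp only [Complex.ofReal_zero, mul_zero, Complex.exp_zero]
  field_simp
  rw [Complex.I_sq]; ring

lemma eeX_eq (ξ : ℤ) (x : ℝ) : eeX ξ x = Real.cos (ξ * x) + Real.sin (ξ * x) * Complex.I := by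
  unfold eeX
  have : Complex.I * x * ξ = ((ξ * x : ℝ) : ℂ) * Complex.I := by push_cast; ring
  rw [this, Complex.exp_mul_I, Complex.ofReal_cos, Complex.ofReal_sin]

lemma eeX_sub_neg (k : ℤ) (x : ℝ) : eeX k x - eeX (-k) x = 2 * Complex.I * Real.sin (k * x) := by
  rw [eeX_eq, eeX_eq]; push_cast; rw [neg_mul, Complex.cos_neg, Complex.sin_neg]; ring

def wX (c : LPCutoff) (m : ℕ) (j : ℕ) : ℝ := c.χ ((2:ℝ) ^ (-(m:ℤ)) * (2 * j + 1)) / (2 * j + 1)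

lemma chi_zeroX (c : LPCutoff) {x : ℝ} (h : 4/3 ≤ |x|) : c.χ x = 0 := by
  by_contra h0
  have := c.supp x h0
  rw [Set.mem_Ioo, ← abs_lt] at this
  linarith

lemma LPlow_hX (c : LPCutoff) (m : ℕ) (x : ℝ) :
    LPlow c m (toC hFun) x = ((2 / Real.pi * ∑ j ∈ Finset.range (2^m), wX c m j * Real.sin ((2*j+1 : ℝ) * x) : ℝ) : ℂ) := by
  have hpow : (0:ℝ) < (2:ℝ)^m := by positivity
  unfold LPlow
  set g : ℤ → ℂ := fun ξ => (c.χ ((2:ℝ) ^ (-(m:ℤ)) * ξ) : ℂ) * fCoeff (toC hFun) ξ * Complex.exp (Complex.I * x * ξ) with hg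
  have i1 : Function.Injective (fun j : ℕ => (2 * (j:ℤ) + 1)) := by intro a b h; simp only at h; omega
  have i2 : Function.Injective (fun j : ℕ => -(2 * (j:ℤ) + 1)) := by intro a b h; simp only at h; omega
  have hsum : ∑' ξ, g ξ = ∑ ξ ∈ (Finset.range (2^m)).image (fun j : ℕ => (2 * (j:ℤ) + 1)) ∪
      (Finset.range (2^m)).image (fun j : ℕ => -(2 * (j:ℤ) + 1)), g ξ := by
    apply tsum_eq_sum
    intro ξ hξ
    simp only [Finset.mem_union, Finset.mem_image, Finset.mem_range, not_or, not_exists, not_and] at hξ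
    rcases Int.even_or_odd ξ with he | ho
    · simp [hg, fCoeff_h_evenX he]
    · have hbig : (2:ℤ)^m * 2 ≤ |ξ| := by
        by_contra hlt
        push Not at hlt
        obtain ⟨k, hk⟩ := ho
        rw [abs_lt] at hlt
        have hcast : ((2^m : ℕ) : ℤ) = 2^m := by push_cast; rfl
        rcases le_or_gt 0 k with hk0 | hk0
        · obtain ⟨j, rfl⟩ := Int.eq_ofNat_of_zero_le hk0
          exact hξ.1 j (by zify; omega) hk.symm
        · obtain ⟨j, hj⟩ := Int.eq_ofNat_of_zero_le (show 0 ≤ -k-1 by omega)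
          exact hξ.2 j (by zify; omega) (by omega)
      have hz : c.χ ((2:ℝ) ^ (-(m:ℤ)) * ξ) = 0 := by
        apply chi_zeroX
        have : (2:ℝ)^m * 2 ≤ |(ξ:ℝ)| := by exact_mod_cast hbig
        rw [abs_mul, abs_of_pos (by positivity), zpow_neg, zpow_natCast, inv_mul_eq_div, le_div_iff₀ hpow]
        linarith
      simp only [hg, hz]; simp
  rw [hsum, Finset.sum_union, Finset.sum_image (fun a _ b _ h => i1 h), Finset.sum_image (fun a _ b _ h => i2 h),
    ← Finset.sum_add_distrib]
  · rw [Complex.ofReal_mul, Complex.ofReal_sum, Finset.mul_sum, Finset.mul_sum]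
    apply Finset.sum_congr rfl
    intro j _
    have o1 : Odd (2 * (j:ℤ) + 1) := ⟨j, rfl⟩
    have e := eeX_sub_neg (2 * (j:ℤ) + 1) x
    have hgp : g (2 * (j:ℤ) + 1) = c.χ ((2:ℝ) ^ (-(m:ℤ)) * (2 * j + 1)) * (-2 * Complex.I / (2 * j + 1)) * eeX (2 * (j:ℤ) + 1) x := by
      simp only [hg, fCoeff_h_oddX o1, eeX]; push_cast; rfl
    have hgn : g (-(2 * (j:ℤ) + 1)) = - c.χ ((2:ℝ) ^ (-(m:ℤ)) * (2 * j + 1)) * (-2 * Complex.I / (2 * j + 1)) * eeX (-(2 * (j:ℤ) + 1)) x := by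
      have := c.even ((2:ℝ) ^ (-(m:ℤ)) * (2 * j + 1))
      simp only [hg, fCoeff_h_oddX o1.neg, eeX]
      rw [← this]; push_cast; 
      rw [show (2:ℝ) ^ (-(m:ℤ)) * -(2 * (j:ℝ) + 1) = -((2:ℝ) ^ (-(m:ℤ)) * (2 * j + 1)) by ring]
      rw [div_neg]; ring_nf
    have hpi : (Real.pi : ℂ) ≠ 0 := by exact_mod_cast Real.pi_ne_zero
    have hj : (2 * (j:ℂ) + 1) ≠ 0 := by exact_mod_cast (show 2 * j + 1 ≠ 0 by omega)
    have : g (2 * (j:ℤ) + 1) + g (-(2 * (j:ℤ) + 1)) = c.χ ((2:ℝ) ^ (-(m:ℤ)) * (2 * j + 1)) * (-2 * Complex.I / (2 * j + 1)) * (2 * Complex.I * Real.sin ((2 * j + 1 : ℝ) * x)) := by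
      rw [hgp, hgn]
      push_cast at e ⊢
      rw [← e]; ring
    rw [this, wX]
    push_cast
    field_simp
    rw [Complex.I_sq]; ring
  · rw [Finset.disjoint_left]
    intro a ha hb
    simp only [Finset.mem_image, Finset.mem_range] at ha hb
    obtain ⟨p, _, hp⟩ := ha
    obtain ⟨q, _, hq⟩ := hb
    omega

lemma wX_anti (c : LPCutoff) (m : ℕ) : Antitone (wX c m) := by
  intro a b h
  unfold wX
  have hab : (a:ℝ) ≤ b := by exact_mod_cast h
  apply div_le_div₀ (c.nonneg _) _ (by positivity) (by linarith)
  apply c.decay (Set.mem_Ici.2 (by positivity)) (Set.mem_Ici.2 (by positivity))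
  gcongr

lemma wX_nonneg (c : LPCutoff) (m : ℕ) (j : ℕ) : 0 ≤ wX c m j :=
  div_nonneg (c.nonneg _) (by positivity)

lemma wX_le (c : LPCutoff) (m : ℕ) (j : ℕ) : wX c m j ≤ 1 / (2 * j + 1) := by
  unfold wX; gcongr; exact c.le_one _

def aX (c : LPCutoff) (m : ℕ) (j : ℕ) : ℝ := 2 / Real.pi * wX c m j

lemma two_piX : 2 / Real.pi ≤ 1 := by
  rw [div_le_one Real.pi_pos]; linarith [Real.pi_gt_three]

lemma aX_nonneg (c : LPCutoff) (m : ℕ) (j : ℕ) : 0 ≤ aX c m j :=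
  mul_nonneg (by positivity) (wX_nonneg c m j)

lemma aX_le (c : LPCutoff) (m : ℕ) (j : ℕ) : aX c m j * (2 * j + 1) ≤ 1 := by
  have h1 := wX_le c m j
  have h3 : aX c m j ≤ 1 * (1 / (2 * j + 1)) :=
    mul_le_mul two_piX h1 (wX_nonneg c m j) zero_le_one
  rw [one_mul, le_div_iff₀ (by positivity)] at h3
  exact h3

def FX (c : LPCutoff) (m : ℕ) (x : ℝ) : ℝ := ∑ j ∈ Finset.range (2^m), aX c m j * Real.sin ((2*j+1 : ℝ) * x)

lemma FX_le (c : LPCutoff) (m : ℕ) (x : ℝ) : |FX c m x| ≤ 3 := by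
  have : FX c m x = 2 / Real.pi * ∑ j ∈ Finset.range (2^m), wX c m j * Real.sin ((2*j+1 : ℝ) * x) := by
    unfold FX aX; rw [Finset.mul_sum]; apply Finset.sum_congr rfl; intros; ring
  rw [this, abs_mul, abs_of_nonneg (by positivity)]
  have h := sin_bddX (wX c m) (wX_anti c m) (wX_nonneg c m) (wX_le c m) x (2^m)
  nlinarith [two_piX, abs_nonneg (∑ j ∈ Finset.range (2^m), wX c m j * Real.sin ((2*j+1 : ℝ) * x))]

lemma fLow_eqX (c : LPCutoff) (m : ℕ) : fLow c (2 * m) = FX c m := by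
  ext x
  unfold fLow FX aX
  have : ((2 * m : ℕ) : ℤ) / 2 = m := by omega
  rw [this, LPlow_hX, Complex.ofReal_re, Finset.mul_sum]
  apply Finset.sum_congr rfl; intros; ring

def GX (b : ℝ) (a : ℕ → ℝ) (J : ℕ) (σ : ℤ) (x : ℝ) : ℂ :=
  eeX σ x + (b / (2 * Complex.I)) * ∑ j ∈ Finset.range J,
    (a j : ℂ) * (eeX (σ + (2 * j + 1)) x + (-1) * eeX (σ - (2 * j + 1)) x)

def GMX (M : ℤ → ℂ) (b : ℝ) (a : ℕ → ℝ) (J : ℕ) (σ : ℤ) (x : ℝ) : ℂ :=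
  M σ * eeX σ x + (b / (2 * Complex.I)) * ∑ j ∈ Finset.range J,
    (a j : ℂ) * (M (σ + (2 * j + 1)) * eeX (σ + (2 * j + 1)) x
      + (-1) * (M (σ - (2 * j + 1)) * eeX (σ - (2 * j + 1)) x))

lemma GX_term (a : ℕ → ℝ) (σ : ℤ) (x : ℝ) (j : ℕ) :
    (a j : ℂ) * (eeX (σ + (2 * j + 1)) x + (-1) * eeX (σ - (2 * j + 1)) x) =
      2 * Complex.I * eeX σ x * (a j * Real.sin ((2 * j + 1 : ℝ) * x) : ℝ) := by
  have e := eeX_sub_neg (2 * (j:ℤ) + 1) x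
  rw [eeX_add σ, sub_eq_add_neg σ, eeX_add σ]
  push_cast at e ⊢
  linear_combination (a j * eeX σ x) * e

lemma GX_eq (b : ℝ) (a : ℕ → ℝ) (J : ℕ) (σ : ℤ) (x : ℝ) :
    GX b a J σ x = eeX σ x * (1 + b * (∑ j ∈ Finset.range J, a j * Real.sin ((2*j+1 : ℝ) * x) : ℝ) : ℂ) := by
  unfold GX
  simp only [GX_term]
  rw [← Finset.mul_sum, ← Complex.ofReal_sum]
  have := Complex.I_ne_zero
  generalize (∑ j ∈ Finset.range J, a j * Real.sin ((2*j+1 : ℝ) * x)) = S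
  field_simp

lemma GX_cont (b : ℝ) (a : ℕ → ℝ) (J : ℕ) (σ : ℤ) : Continuous (GX b a J σ) := by
  have := eeX_cont
  unfold GX; fun_prop

lemma OpX_G {M : ℤ → ℂ} (hM : M.support.Finite) (b : ℝ) (a : ℕ → ℝ) (J : ℕ) (σ : ℤ) (x : ℝ) :
    OpX M (GX b a J σ) x = GMX M b a J σ x := by
  have := eeX_cont
  unfold GX GMX
  rw [OpX_add hM (by fun_prop) (by fun_prop), OpX_ee, OpX_smul, OpX_sum hM _ (by intro j; fun_prop)]
  congr 2
  apply Finset.sum_congr rfl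
  intro j _
  rw [OpX_smul, OpX_add hM (by fun_prop) (by fun_prop), OpX_smul, OpX_ee, OpX_ee]

def vX (A b : ℝ) (a : ℕ → ℝ) (J : ℕ) (N : ℤ) (x : ℝ) : ℂ :=
  b * eeX 0 x + (A / 2) * (GX b a J N x + GX b a J (-N) x)

lemma OpX_v {M : ℤ → ℂ} (hM : M.support.Finite) (A b : ℝ) (a : ℕ → ℝ) (J : ℕ) (N : ℤ) (x : ℝ) :
    OpX M (vX A b a J N) x = b * (M 0 * eeX 0 x) + (A / 2) * (GMX M b a J N x + GMX M b a J (-N) x) := by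
  have h1 := eeX_cont
  have h2 := GX_cont b a J
  unfold vX
  rw [OpX_add hM (by fun_prop) (by fun_prop), OpX_smul, OpX_smul, OpX_ee, OpX_add hM (by fun_prop) (by fun_prop),
    OpX_G hM, OpX_G hM]

lemma vX_eq (A b : ℝ) (a : ℕ → ℝ) (J : ℕ) (N : ℤ) (x : ℝ) :
    vX A b a J N x = (A * Real.cos (N * x) * (1 + b * ∑ j ∈ Finset.range J, a j * Real.sin ((2*j+1 : ℝ) * x)) + b : ℝ) := by
  unfold vX
  rw [GX_eq, GX_eq, eeX_eq, eeX_eq, eeX_eq]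
  push_cast
  rw [neg_mul, Complex.cos_neg, Complex.sin_neg]
  simp
  ring

lemma v0_eqX (c : LPCutoff) (m : ℕ) : toC (v0NV c (2*m)) =
    vX ((2:ℝ) ^ (-((2*m : ℕ):ℤ)) * ((2*m : ℕ):ℝ) ^ (-(1:ℝ)/4) * Real.log (2*m : ℕ)) (((2*m : ℕ):ℝ) ^ (-(1:ℝ)/4))
      (aX c m) (2^m) (2^(2*m)) := by
  ext x
  rw [vX_eq, toC, v0NV, fLow_eqX]
  unfold FX
  push_cast
  rfl

lemma GMX_zero (M : ℤ → ℂ) (b : ℝ) (a : ℕ → ℝ) (J : ℕ) (N : ℤ) (σ : ℤ) (hσ : |σ| = N) (x : ℝ)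
    (hJ : 8 * (J:ℤ) ≤ N)
    (hM : ∀ ξ : ℤ, 3 * N ≤ 4 * |ξ| → 4 * |ξ| ≤ 5 * N → M ξ = 0) : GMX M b a J σ x = 0 := by
  have key : ∀ d : ℤ, |d| ≤ 2 * J → M (σ + d) = 0 := by
    intro d hd
    have h1 := abs_add_le σ d
    have h2 := abs_sub_abs_le_abs_sub σ (-d)
    rw [sub_neg_eq_add, abs_neg] at h2
    apply hM <;> omega
  unfold GMX
  have h0 := key 0 (by simp)
  rw [add_zero] at h0
  rw [h0, Finset.sum_eq_zero]
  · simp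
  · intro j hj
    rw [Finset.mem_range] at hj
    rw [key (2*j+1) (by rw [abs_of_nonneg] <;> omega), sub_eq_add_neg, key (-(2*j+1)) (by rw [abs_neg, abs_of_nonneg] <;> omega)]
    simp

lemma GMX_bound (M : ℤ → ℂ) (b : ℝ) (hb0 : 0 ≤ b) (hb : b ≤ 1) (a : ℕ → ℝ) (J : ℕ) (σ : ℤ) (x : ℝ)
    (ha0 : ∀ j, 0 ≤ a j) (ha : ∀ j : ℕ, a j * (2 * j + 1) ≤ 1)
    (hF : |∑ j ∈ Finset.range J, a j * Real.sin ((2*j+1 : ℝ) * x)| ≤ 3) (L : ℝ) (hL : 0 ≤ L)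
    (hM1 : ∀ ξ, ‖M ξ‖ ≤ 1) (hM : ∀ ξ η : ℤ, ‖M ξ - M η‖ ≤ L * |(ξ:ℝ) - η|) :
    ‖GMX M b a J σ x‖ ≤ 4 + J * L := by
  have e : GMX M b a J σ x = M σ * GX b a J σ x + (b / (2 * Complex.I)) * ∑ j ∈ Finset.range J,
    (a j : ℂ) * ((M (σ + (2 * j + 1)) - M σ) * eeX (σ + (2 * j + 1)) x
      + (-1) * ((M (σ - (2 * j + 1)) - M σ) * eeX (σ - (2 * j + 1)) x)) := by
    unfold GMX GX
    rw [mul_add, mul_left_comm (M σ), Finset.mul_sum (a := M σ), add_assoc, ← mul_add, ← Finset.sum_add_distrib]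
    congr 2
    apply Finset.sum_congr rfl
    intro j _; ring
  rw [e]
  have n1 : ‖M σ * GX b a J σ x‖ ≤ 4 := by
    rw [GX_eq, norm_mul, norm_mul, eeX_norm, one_mul]
    have h1 : ‖(1 + b * (∑ j ∈ Finset.range J, a j * Real.sin ((2*j+1 : ℝ) * x) : ℝ) : ℂ)‖ ≤ 4 := by
      refine (norm_add_le _ _).trans ?_
      rw [norm_mul, Complex.norm_real, Complex.norm_real, norm_one, Real.norm_eq_abs, Real.norm_eq_abs, abs_of_nonneg hb0]
      nlinarith [abs_nonneg (∑ j ∈ Finset.range J, a j * Real.sin ((2*j+1 : ℝ) * x))]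
    calc _ ≤ 1 * (4:ℝ) := mul_le_mul (hM1 σ) h1 (norm_nonneg _) zero_le_one
      _ = 4 := by ring
  have n2 : ∀ j ∈ Finset.range J, ‖(a j : ℂ) * ((M (σ + (2 * j + 1)) - M σ) * eeX (σ + (2 * j + 1)) x
      + (-1) * ((M (σ - (2 * j + 1)) - M σ) * eeX (σ - (2 * j + 1)) x))‖ ≤ 2 * L := by
    intro j _
    rw [norm_mul, Complex.norm_real, Real.norm_eq_abs, abs_of_nonneg (ha0 j)]
    have p1 := hM (σ + (2 * j + 1)) σ
    have p2 := hM (σ - (2 * j + 1)) σ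
    have q1 : |((σ + (2 * j + 1) : ℤ) : ℝ) - σ| = 2 * j + 1 := by
      push_cast; rw [add_sub_cancel_left, abs_of_nonneg (by positivity)]
    have q2 : |((σ - (2 * j + 1) : ℤ) : ℝ) - σ| = 2 * j + 1 := by
      push_cast; rw [sub_sub_cancel_left, abs_neg, abs_of_nonneg (by positivity)]
    rw [q1] at p1
    rw [q2] at p2
    have := norm_add_le ((M (σ + (2 * j + 1)) - M σ) * eeX (σ + (2 * j + 1)) x)
      ((-1) * ((M (σ - (2 * j + 1)) - M σ) * eeX (σ - (2 * j + 1)) x))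
    rw [norm_mul, norm_mul, norm_mul, eeX_norm, eeX_norm, norm_neg, norm_one, mul_one, mul_one, one_mul] at this
    have t := mul_le_mul_of_nonneg_left (this.trans (add_le_add p1 p2)) (ha0 j)
    have := mul_le_mul_of_nonneg_left (ha j) hL
    linarith
  have n3 := (norm_sum_le _ _).trans (Finset.sum_le_sum n2)
  simp only [Finset.sum_const, Finset.card_range, nsmul_eq_mul] at n3
  refine (norm_add_le _ _).trans ?_
  rw [norm_mul (b / (2 * Complex.I) : ℂ)]
  have n4 : ‖(b / (2 * Complex.I) : ℂ)‖ ≤ 1 / 2 := by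
    rw [norm_div, norm_mul, Complex.norm_I, Complex.norm_real, Real.norm_eq_abs, abs_of_nonneg hb0]
    simp; linarith
  have := mul_le_mul n4 n3 (norm_nonneg _) (by norm_num)
  linarith

lemma chi_lipX (c : LPCutoff) : ∃ L : ℝ, 0 ≤ L ∧ ∀ x y, |c.χ x - c.χ y| ≤ L * |x - y| := by
  have hs : HasCompactSupport c.χ := by
    apply HasCompactSupport.of_support_subset_isCompact (K := Set.Icc (-(4/3)) (4/3)) isCompact_Icc
    intro x hx
    exact Set.Ioo_subset_Icc_self (c.supp x hx)
  obtain ⟨C, hC⟩ := ContDiff.lipschitzWith_of_hasCompactSupport hs c.smooth (by simp)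
  refine ⟨C, C.2, fun x y => ?_⟩
  have := hC.dist_le_mul x y
  rwa [Real.dist_eq, Real.dist_eq] at this

def MX (c : LPCutoff) (j : ℤ) (ξ : ℤ) : ℂ :=
  if j = -1 then (c.χ ξ : ℂ) else (c.phi ((2:ℝ) ^ (-j) * ξ) : ℂ)

lemma LPblock_eqX (c : LPCutoff) (j : ℤ) (u : ℝ → ℂ) : LPblock c j u = OpX (MX c j) u := by
  ext x
  unfold LPblock OpX MX
  split_ifs <;> rfl

lemma finite_absX (R : ℝ) : {ξ : ℤ | |(ξ:ℝ)| < R}.Finite := by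
  apply (Set.finite_Icc (-⌈R⌉) ⌈R⌉).subset
  intro ξ hξ
  rw [Set.mem_ofPred_eq, abs_lt] at hξ
  have := Int.le_ceil R
  constructor
  · have : (-(⌈R⌉:ℝ)) ≤ ξ := by linarith [hξ.1]
    exact_mod_cast this
  · have : (ξ:ℝ) ≤ ⌈R⌉ := by linarith [hξ.2]
    exact_mod_cast this

lemma phi_zero_farX (c : LPCutoff) {x : ℝ} (h : 8/3 ≤ |x|) : c.phi x = 0 := by
  unfold LPCutoff.phi
  rw [chi_zeroX c (x := x) (by linarith), chi_zeroX c (x := x/2)]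
  · simp
  · rw [abs_div, abs_two]; linarith

lemma phi_zero_nearX (c : LPCutoff) {x : ℝ} (h : |x| ≤ 3/4) : c.phi x = 0 := by
  unfold LPCutoff.phi
  have h2 : |x/2| ≤ 3/4 := by rw [abs_div, abs_two]; linarith [abs_nonneg x]
  rw [c.eq_one x (abs_le.1 h), c.eq_one (x/2) (abs_le.1 h2)]
  simp

lemma MX_fin (c : LPCutoff) (j : ℤ) : (MX c j).support.Finite := by
  unfold MX
  split_ifs with h
  · apply (finite_absX (4/3)).subset
    intro ξ hξ
    by_contra h0
    simp only [Set.mem_ofPred_eq, not_lt] at h0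
    exact hξ (by simp [chi_zeroX c h0])
  · have hp : (0:ℝ) < (2:ℝ)^(-j) := by positivity
    apply (finite_absX ((8/3) / (2:ℝ)^(-j))).subset
    intro ξ hξ
    by_contra h0
    simp only [Set.mem_ofPred_eq, not_lt] at h0
    apply hξ
    rw [div_le_iff₀ hp] at h0
    simp only
    rw [phi_zero_farX c]
    · simp
    · rw [abs_mul, abs_of_pos hp]; linarith

lemma MX_zero (c : LPCutoff) {j : ℤ} (hj : j ≠ -1) : MX c j 0 = 0 := by
  unfold MX
  rw [if_neg hj, phi_zero_nearX c]
  · simp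
  · norm_num

lemma MX_one (c : LPCutoff) (j : ℤ) (ξ : ℤ) : ‖MX c j ξ‖ ≤ 1 := by
  unfold MX
  split_ifs
  · rw [Complex.norm_real, Real.norm_eq_abs, abs_le]
    constructor <;> linarith [c.nonneg ξ, c.le_one ξ]
  · rw [Complex.norm_real, Real.norm_eq_abs, abs_le]
    unfold LPCutoff.phi
    generalize (2:ℝ) ^ (-j) * ξ = y
    constructor <;> linarith [c.nonneg y, c.le_one y, c.nonneg (y/2), c.le_one (y/2)]

lemma MX_lip (c : LPCutoff) {j : ℤ} (hj : j ≠ -1) (L : ℝ) (h0 : 0 ≤ L)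
    (hL : ∀ x y, |c.χ x - c.χ y| ≤ L * |x - y|) (ξ η : ℤ) :
    ‖MX c j ξ - MX c j η‖ ≤ (2 * L * (2:ℝ)^(-j)) * |(ξ:ℝ) - η| := by
  unfold MX
  rw [if_neg hj, if_neg hj, ← Complex.ofReal_sub, Complex.norm_real, Real.norm_eq_abs]
  unfold LPCutoff.phi
  have hp : (0:ℝ) < (2:ℝ)^(-j) := by positivity
  have e1 : |(2:ℝ)^(-j) * ξ - (2:ℝ)^(-j) * η| = (2:ℝ)^(-j) * |(ξ:ℝ) - η| := by
    rw [← mul_sub, abs_mul, abs_of_pos hp]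
  generalize (2:ℝ) ^ (-j) * ξ = y at *
  generalize (2:ℝ) ^ (-j) * η = z at *
  have e2 : |y / 2 - z / 2| = |y - z| / 2 := by rw [← sub_div, abs_div, abs_two]
  have p1 := hL y z
  have p2 := hL (y/2) (z/2)
  rw [e2] at p2
  have q : c.χ (y/2) - c.χ y - (c.χ (z/2) - c.χ z) = (c.χ (y/2) - c.χ (z/2)) - (c.χ y - c.χ z) := by ring
  rw [q, mul_assoc, ← e1]
  have := abs_sub (c.χ (y/2) - c.χ (z/2)) (c.χ y - c.χ z)
  have := mul_nonneg h0 (abs_nonneg (y - z))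
  linarith

lemma supX {E : Type*} [NormedAddCommGroup E] (f : ℝ → E) (r : ℝ) (h : ∀ x, ‖f x‖ ≤ r) :
    supNormE f ≤ ENNReal.ofReal r := by
  unfold supNormE
  apply iSup_le
  intro x
  rw [← enorm_eq_nnnorm, ← ofReal_norm]
  exact ENNReal.ofReal_le_ofReal (h x)

lemma block_vX (c : LPCutoff) (j : ℤ) (A b : ℝ) (a : ℕ → ℝ) (J : ℕ) (N : ℤ)
    (hN : 0 ≤ N) (hJ : 8 * (J:ℤ) ≤ N)
    (hM : ∀ ξ : ℤ, 3 * N ≤ 4 * |ξ| → 4 * |ξ| ≤ 5 * N → MX c j ξ = 0) (x : ℝ) :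
    LPblock c j (vX A b a J N) x = b * MX c j 0 := by
  rw [LPblock_eqX, OpX_v (MX_fin c j), GMX_zero (N := N) _ _ _ _ _ (abs_of_nonneg hN) _ hJ hM,
    GMX_zero (N := N) _ _ _ _ _ (by rw [abs_neg, abs_of_nonneg hN]) _ hJ hM]
  simp [eeX]

lemma block_bdX (c : LPCutoff) (j : ℤ) (hj : j ≠ -1) (A b : ℝ) (hA : 0 ≤ A) (hb0 : 0 ≤ b) (hb : b ≤ 1) (m : ℕ) (N : ℤ)
    (L : ℝ) (h0 : 0 ≤ L) (hL : ∀ x y, |c.χ x - c.χ y| ≤ L * |x - y|) (x : ℝ) :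
    ‖LPblock c j (vX A b (aX c m) (2^m) N) x‖ ≤ A * (4 + 2^m * (2 * L * (2:ℝ)^(-j))) := by
  rw [LPblock_eqX, OpX_v (MX_fin c j), MX_zero c hj]
  have g := fun σ => GMX_bound (MX c j) b hb0 hb (aX c m) (2^m) σ x (aX_nonneg c m) (aX_le c m)
    (FX_le c m x) (2 * L * (2:ℝ)^(-j)) (by positivity) (MX_one c j) (MX_lip c hj L h0 hL)
  push_cast at g
  have t := (norm_add_le (GMX (MX c j) b (aX c m) (2^m) N x) (GMX (MX c j) b (aX c m) (2^m) (-N) x)).trans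
    (add_le_add (g N) (g (-N)))
  rw [zero_mul, mul_zero, zero_add, norm_mul]
  have : ‖((A:ℂ) / 2)‖ = A / 2 := by
    rw [norm_div, Complex.norm_real, Real.norm_eq_abs, abs_of_nonneg hA]; simp
  rw [this]
  have := mul_le_mul_of_nonneg_left t (show 0 ≤ A / 2 by positivity)
  linarith

lemma zero_farX (c : LPCutoff) (m : ℕ) (hm : 4 ≤ m) (j : ℤ) (hj0 : -1 ≤ j) (hj1 : j ≠ (2*m : ℕ)) (hj2 : j ≠ (2*m : ℕ) - 1)
    (ξ : ℤ) (h1 : 3 * (2:ℤ)^(2*m) ≤ 4 * |ξ|) (h2 : 4 * |ξ| ≤ 5 * (2:ℤ)^(2*m)) : MX c j ξ = 0 := by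
  have h1' : 3 * (2:ℝ)^(2*m) ≤ 4 * |(ξ:ℝ)| := by exact_mod_cast h1
  have h2' : 4 * |(ξ:ℝ)| ≤ 5 * (2:ℝ)^(2*m) := by exact_mod_cast h2
  have hp : (0:ℝ) < (2:ℝ)^(-j) := by positivity
  unfold MX
  split_ifs with h
  · have : (2:ℝ)^2 ≤ (2:ℝ)^(2*m) := pow_le_pow_right₀ (by norm_num) (by omega)
    rw [chi_zeroX c (by linarith)]; simp
  · rcases lt_or_ge j ((2*m : ℕ) - 1) with hlt | hge
    · rw [phi_zero_farX c]
      · simp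
      · rw [abs_mul, abs_of_pos hp]
        have : (2:ℝ)^(2:ℤ) ≤ (2:ℝ)^(-j) * (2:ℝ)^(2*m) := by
          rw [← zpow_natCast, ← zpow_add₀ (by norm_num)]
          exact zpow_le_zpow_right₀ (by norm_num) (by omega)
        rw [show (2:ℝ)^(2:ℤ) = 4 by norm_num] at this
        have := mul_le_mul_of_nonneg_left h1' hp.le
        linarith
    · rw [phi_zero_nearX c]
      · simp
      · rw [abs_mul, abs_of_pos hp]
        have : (2:ℝ)^(-j) * (2:ℝ)^(2*m) ≤ (2:ℝ)^(-1:ℤ) := by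
          rw [← zpow_natCast, ← zpow_add₀ (by norm_num)]
          exact zpow_le_zpow_right₀ (by norm_num) (by omega)
        rw [show (2:ℝ)^(-1:ℤ) = 1/2 by norm_num] at this
        have := mul_le_mul_of_nonneg_left h2' hp.le
        linarith

lemma FX_deriv (c : LPCutoff) (m : ℕ) (x : ℝ) :
    ∃ d : ℝ, |d| ≤ 2^m ∧ HasDerivAt (FX c m) d x := by
  refine ⟨∑ j ∈ Finset.range (2^m), aX c m j * (Real.cos ((2*j+1 : ℝ) * x) * (2*j+1)), ?_, ?_⟩
  · refine (Finset.abs_sum_le_sum_abs _ _).trans ?_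
    have : ∀ j ∈ Finset.range (2^m), |aX c m j * (Real.cos ((2*j+1 : ℝ) * x) * (2*j+1))| ≤ 1 := by
      intro j _
      rw [abs_mul, abs_mul, abs_of_nonneg (aX_nonneg c m j), abs_of_nonneg (show (0:ℝ) ≤ 2*j+1 by positivity)]
      have h1 := aX_le c m j
      have h2 := Real.abs_cos_le_one ((2*j+1 : ℝ) * x)
      have h3 : 0 ≤ aX c m j * (2*j+1) := mul_nonneg (aX_nonneg c m j) (by positivity)
      calc _ = (aX c m j * (2*j+1)) * |Real.cos ((2*j+1 : ℝ) * x)| := by ring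
        _ ≤ 1 * 1 := mul_le_mul h1 h2 (abs_nonneg _) zero_le_one
        _ = 1 := by ring
    refine (Finset.sum_le_sum this).trans ?_
    simp
  · unfold FX
    apply HasDerivAt.fun_sum
    intro j _
    have := ((hasDerivAt_id x).const_mul (2*j+1 : ℝ)).sin.const_mul (aX c m j)
    simpa using this

lemma two_zpowX (k : ℤ) : (2:ℝ≥0∞) ^ k = ENNReal.ofReal ((2:ℝ)^k) := by
  have h : (2:ℝ≥0∞) = ((2:ℝ≥0) : ℝ≥0∞) := rfl
  rw [h, ← ENNReal.coe_zpow (by norm_num)]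
  rw [← ENNReal.ofReal_coe_nnreal]
  simp

/-- Bounds for the Novikov initial data: for all sufficiently large `n ∈ 16ℕ`,
`2^n ‖v_{0,n} - n^{-1/4}‖_{L^∞} + ‖∂_x v_{0,n}‖_{L^∞} ≤ C n^{-1/4} log n` and
`‖v_{0,n}‖_{B^1_{∞,1}} ≤ C n^{-1/4} log n`. -/
theorem v0NV_bounds (c : LPCutoff) :
    ∃ C : ℝ, 0 < C ∧ ∃ N : ℕ, ∀ n : ℕ, 16 ∣ n → N ≤ n →
      (2:ℝ≥0∞) ^ (n : ℕ) * supNormE (fun x => v0NV c n x - (n:ℝ) ^ (-(1:ℝ)/4)) +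
          supNormE (deriv (v0NV c n)) ≤
        ENNReal.ofReal (C * (n:ℝ) ^ (-(1:ℝ)/4) * Real.log n) ∧
      besov1E c (toC (v0NV c n)) ≤ ENNReal.ofReal (C * (n:ℝ) ^ (-(1:ℝ)/4) * Real.log n) := by
  obtain ⟨L, hL0, hL⟩ := chi_lipX c
  refine ⟨9 + 4 * L, by positivity, 16, ?_⟩
  intro n hn hn16
  obtain ⟨m, rfl⟩ : ∃ m, n = 2 * m := ⟨n / 2, by omega⟩
  have hm : 4 ≤ m := by omega
  set n := 2 * m with hnm
  set b : ℝ := (n:ℝ) ^ (-(1:ℝ)/4) with hb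
  set l : ℝ := Real.log n with hl
  set A : ℝ := (2:ℝ) ^ (-(n:ℤ)) * b * l with hA
  have hnR : (16:ℝ) ≤ n := by exact_mod_cast hn16
  have hb0 : 0 ≤ b := by positivity
  have hb1 : b ≤ 1 := Real.rpow_le_one_of_one_le_of_nonpos (by linarith) (by norm_num)
  have hl1 : 1 ≤ l := by
    rw [hl, Real.le_log_iff_exp_le (by linarith)]
    linarith [Real.exp_one_lt_d9]
  have hA0 : 0 ≤ A := by positivity
  have hNA : (2:ℝ)^n * A = b * l := by
    rw [hA, zpow_neg, zpow_natCast]; field_simp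
  have hJN : (2:ℝ)^m ≤ (2:ℝ)^n := pow_le_pow_right₀ (by norm_num) (by omega)
  have hJN8 : 8 * (((2^m : ℕ)) : ℤ) ≤ 2^n := by
    have : (2:ℤ)^(3 + m) ≤ 2^n := pow_le_pow_right₀ (by norm_num) (by omega)
    rw [pow_add] at this
    push_cast; linarith
  have hbl : 0 ≤ b * l := by positivity
  have hF : ∀ x, |1 + b * FX c m x| ≤ 4 := by
    intro x
    have := abs_add_le 1 (b * FX c m x)
    rw [abs_one, abs_mul, abs_of_nonneg hb0] at this
    have := FX_le c m x
    nlinarith [abs_nonneg (FX c m x)]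
  have hv : v0NV c n = fun x => A * Real.cos ((2:ℝ)^n * x) * (1 + b * FX c m x) + b := by
    ext x; rw [v0NV, hnm, fLow_eqX]
  constructor
  · have s1 : supNormE (fun x => v0NV c n x - b) ≤ ENNReal.ofReal (4 * A) := by
      apply supX
      intro x
      rw [hv]
      simp only [add_sub_cancel_right]
      rw [Real.norm_eq_abs, abs_mul, abs_mul, abs_of_nonneg hA0]
      have h1 := Real.abs_cos_le_one ((2:ℝ)^n * x)
      calc _ ≤ A * 1 * 4 := by gcongr; exact hF x
        _ = _ := by ring
    have s2 : supNormE (deriv (v0NV c n)) ≤ ENNReal.ofReal (5 * (b * l)) := by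
      apply supX
      intro x
      obtain ⟨d, hd, hdF⟩ := FX_deriv c m x
      have hcos := ((hasDerivAt_id x).const_mul ((2:ℝ)^n)).cos.const_mul A
      have hder := (hcos.mul ((hdF.const_mul b).const_add 1)).add_const b
      have hder' : deriv (v0NV c n) x = A * (-Real.sin (2 ^ n * id x) * (2 ^ n * 1)) * (1 + b * FX c m x) + A * Real.cos (2 ^ n * id x) * (b * d) := by rw [hv]; exact hder.deriv
      rw [hder', Real.norm_eq_abs]
      simp only [id, mul_one]
      clear hder' hder hcos s1 hv hA
      clear_value A
      refine (abs_add_le _ _).trans ?_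
      rw [abs_mul, abs_mul, abs_mul, abs_mul, abs_mul, abs_mul, abs_neg, abs_of_nonneg hA0, abs_of_nonneg hb0,
        abs_of_nonneg (show (0:ℝ) ≤ 2^n by positivity)]
      have h1 := Real.abs_cos_le_one ((2:ℝ)^n * x)
      have h2 := Real.abs_sin_le_one ((2:ℝ)^n * x)
      calc _ ≤ A * (1 * 2^n) * 4 + A * 1 * (1 * 2^n) := by
            gcongr
            · exact hF x
            · exact hd.trans hJN
        _ = 5 * (2^n * A) := by ring
        _ = _ := by rw [hNA]
    have s3 : (2:ℝ≥0∞)^n = ENNReal.ofReal ((2:ℝ)^n) := by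
      rw [ENNReal.ofReal_pow (by norm_num)]; simp
    calc _ ≤ ENNReal.ofReal ((2:ℝ)^n) * ENNReal.ofReal (4 * A) + ENNReal.ofReal (5 * (b * l)) := by
          rw [s3]; gcongr
      _ = ENNReal.ofReal ((2:ℝ)^n * (4 * A) + 5 * (b * l)) := by
          rw [ENNReal.ofReal_add (by positivity) (by positivity), ENNReal.ofReal_mul (p := (2:ℝ)^n) (by positivity)]
      _ ≤ _ := by
          apply ENNReal.ofReal_le_ofReal
          have : (2:ℝ)^n * (4 * A) = 4 * (b * l) := by rw [← hNA]; ring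
          rw [this]
          nlinarith
  · have hvX : toC (v0NV c n) = vX A b (aX c m) (2^m) (2^n) := v0_eqX c m
    rw [hvX]
    unfold besov1E
    rw [tsum_eq_sum (s := {0, n, n+1})]
    · rw [Finset.sum_insert (by simp; omega), Finset.sum_insert (by simp), Finset.sum_singleton]
      have t0 : (2:ℝ≥0∞) ^ (((0:ℕ):ℤ) - 1) * supNormE (LPblock c (((0:ℕ):ℤ) - 1) (vX A b (aX c m) (2^m) (2^n)))
          ≤ ENNReal.ofReal (b * l) := by
        rw [two_zpowX]
        calc _ ≤ ENNReal.ofReal ((2:ℝ) ^ (((0:ℕ):ℤ) - 1)) * ENNReal.ofReal b := by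
              gcongr
              apply supX
              intro x
              rw [block_vX c _ A b _ _ _ (by positivity) hJN8
                (zero_farX c m hm _ (by simp) (by simp; omega) (by simp; omega)), norm_mul,
                Complex.norm_real, Real.norm_eq_abs, abs_of_nonneg hb0]
              exact mul_le_of_le_one_right hb0 (MX_one c _ _)
          _ = ENNReal.ofReal ((2:ℝ) ^ (((0:ℕ):ℤ) - 1) * b) := by rw [ENNReal.ofReal_mul (by positivity)]
          _ ≤ _ := by
              apply ENNReal.ofReal_le_ofReal
              norm_num
              nlinarith
      have t1 : ∀ k : ℕ, 1 ≤ k → k ≤ n + 1 →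
          (2:ℝ≥0∞) ^ ((k:ℤ) - 1) * supNormE (LPblock c ((k:ℤ) - 1) (vX A b (aX c m) (2^m) (2^n)))
          ≤ ENNReal.ofReal ((4 + 2 * L) * (b * l)) := by
        intro k hk1 hk
        rw [two_zpowX]
        calc _ ≤ ENNReal.ofReal ((2:ℝ) ^ ((k:ℤ) - 1)) *
                ENNReal.ofReal (A * (4 + 2^m * (2 * L * (2:ℝ)^(-((k:ℤ) - 1))))) := by
              gcongr
              apply supX
              intro x
              exact block_bdX c _ (by omega) A b hA0 hb0 hb1 m _ L hL0 hL x
          _ = ENNReal.ofReal ((2:ℝ) ^ ((k:ℤ) - 1) * (A * (4 + 2^m * (2 * L * (2:ℝ)^(-((k:ℤ) - 1)))))) := by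
              rw [ENNReal.ofReal_mul (p := (2:ℝ) ^ ((k:ℤ) - 1)) (by positivity)]
          _ ≤ _ := by
              apply ENNReal.ofReal_le_ofReal
              have hz : (2:ℝ) ^ ((k:ℤ) - 1) ≤ 2^n := by
                rw [← zpow_natCast]
                exact zpow_le_zpow_right₀ (by norm_num) (by omega)
              have hzz : (2:ℝ) ^ ((k:ℤ) - 1) * (2:ℝ)^(-((k:ℤ) - 1)) = 1 := by
                rw [← zpow_add₀ (by norm_num)]; simp
              calc _ = 4 * ((2:ℝ) ^ ((k:ℤ) - 1) * A) + 2 * L * (2^m * A) * ((2:ℝ) ^ ((k:ℤ) - 1) * (2:ℝ)^(-((k:ℤ) - 1))) := by ring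
                _ ≤ 4 * (2^n * A) + 2 * L * (2^n * A) * 1 := by rw [hzz]; gcongr
                _ = _ := by rw [hNA]; ring
      calc _ ≤ ENNReal.ofReal (b * l) + (ENNReal.ofReal ((4 + 2 * L) * (b * l)) + ENNReal.ofReal ((4 + 2 * L) * (b * l))) := by
            gcongr
            · exact t1 n (by omega) (by omega)
            · exact t1 (n+1) (by omega) (by omega)
        _ = ENNReal.ofReal (b * l + ((4 + 2 * L) * (b * l) + (4 + 2 * L) * (b * l))) := by
            rw [ENNReal.ofReal_add hbl (by positivity), ENNReal.ofReal_add (by positivity) (by positivity)]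
        _ ≤ _ := by
            apply ENNReal.ofReal_le_ofReal
            linarith
    · intro k hk
      simp only [Finset.mem_insert, Finset.mem_singleton, not_or] at hk
      have : supNormE (LPblock c ((k:ℤ) - 1) (vX A b (aX c m) (2^m) (2^n))) ≤ ENNReal.ofReal 0 := by
        apply supX
        intro x
        rw [block_vX c _ A b _ _ _ (by positivity) hJN8
                (zero_farX c m hm _ (by omega) (by omega) (by omega)), MX_zero c (by omega)]
        simp
      rw [ENNReal.ofReal_zero, nonpos_iff_eq_zero] at this
      rw [this, mul_zero]
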